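/- Let T be a finite tree of order at least 3 with maximum degree Δ that is either a symmetric tree or a bisymmetric tree. Then D'(T) = Δ. -/

import Mathlib

/-- An edge labeling `f` of `G` with values in `Fin d` is *distinguishing* if the identity is the
only automorphism of `G` preserving it. -/
def SimpleGraph.IsDistinguishingEdgeLabeling {V : Type*} (G : SimpleGraph V) {d : ℕ}
    (f : G.edgeSet → Fin d) : Prop :=
  ∀ φ : G ≃g G, (∀ e : G.edgeSet, f (φ.mapEdgeSet e) = f e) → ∀ v : V, φ v = v

/-- The distinguishing index `D'(G)`: the least number of labels in a distinguishing edge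
labeling of `G`. -/
noncomputable def SimpleGraph.distinguishingIndex {V : Type*} (G : SimpleGraph V) : ℕ :=
  sInf {d : ℕ | ∃ f : G.edgeSet → Fin d, G.IsDistinguishingEdgeLabeling f}
/-- A *symmetric tree*: a tree with a central vertex `v₀` such that all leaves are at the same
distance from `v₀` and all non-leaf vertices have the same degree. -/
def SimpleGraph.IsSymmetricTree {V : Type*} [Fintype V] (G : SimpleGraph V)
    [DecidableRel G.Adj] : Prop :=
  G.IsTree ∧ ∃ v₀ : V,
    (∃ ℓ : ℕ, ∀ v : V, G.degree v = 1 → G.dist v₀ v = ℓ) ∧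
    (∃ k : ℕ, ∀ v : V, G.degree v ≠ 1 → G.degree v = k)

/-- A *bisymmetric tree*: a tree with a central edge `u₀v₀` such that all leaves are at the same
distance from the edge and all non-leaf vertices have the same degree. -/
def SimpleGraph.IsBisymmetricTree {V : Type*} [Fintype V] (G : SimpleGraph V)
    [DecidableRel G.Adj] : Prop :=
  G.IsTree ∧ ∃ u₀ v₀ : V, G.Adj u₀ v₀ ∧
    (∃ ℓ : ℕ, ∀ v : V, G.degree v = 1 → min (G.dist u₀ v) (G.dist v₀ v) = ℓ) ∧
    (∃ k : ℕ, ∀ v : V, G.degree v ≠ 1 → G.degree v = k)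

namespace SimpleGraph

variable {V : Type*} {T : SimpleGraph V} {u v x y z : V}

/-- The distance from `x` to the set `{u, v}`. -/
noncomputable def depth (T : SimpleGraph V) (u v x : V) : ℕ := min (T.dist u x) (T.dist v x)

theorem IsTree.eq_of_adj_of_dist_le (hT : T.IsTree) (r : V) (hy : T.Adj x y) (hz : T.Adj x z)
    (hdy : T.dist r y ≤ T.dist r x) (hdz : T.dist r z ≤ T.dist r x) : y = z := by
  obtain ⟨p, hp, hpl⟩ := hT.connected.exists_path_of_dist r x
  have key : ∀ w, T.Adj x w → T.dist r w ≤ T.dist r x → w = p.penultimate := by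
    intro w hw hdw
    have hlen : T.dist r x = T.dist r w + 1 := by
      rcases hT.dist_eq_dist_add_one_of_adj r hw with h | h <;> omega
    obtain ⟨q, hq⟩ := hT.connected.exists_walk_length_eq_dist r w
    have hq' : (q.concat hw.symm).IsPath :=
      Walk.isPath_of_length_eq_dist _ (by rw [Walk.length_concat, hq, hlen])
    have := (hT.isAcyclic.subsingleton_path r x).elim ⟨p, hp⟩ ⟨_, hq'⟩
    have h2 : p = q.concat hw.symm := congrArg Subtype.val this
    rw [h2, Walk.penultimate_concat]
  rw [key y hy hdy, key z hz hdz]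

theorem Connected.exists_adj_dist_eq_add_one (hT : T.Connected) (r : V) (hx : 0 < T.dist r x) :
    ∃ y, T.Adj x y ∧ T.dist r x = T.dist r y + 1 := by
  obtain ⟨p, hp⟩ := hT.exists_walk_length_eq_dist r x
  have hnil : ¬ p.Nil := by
    rw [← Walk.length_eq_zero_iff]; omega
  have hadj := p.adj_penultimate hnil
  refine ⟨p.penultimate, hadj.symm, ?_⟩
  have h1 := dist_le p.dropLast
  have h2 : p.dropLast.length + 1 = p.length := Walk.length_dropLast_add_one hnil
  have := hadj.symm.diff_dist_adj (u := r)
  omega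

theorem depth_eq_zero_iff (hT : T.Connected) : T.depth u v x = 0 ↔ x = u ∨ x = v := by
  rw [depth, Nat.min_eq_zero_iff, hT.dist_eq_zero_iff, hT.dist_eq_zero_iff, eq_comm, @eq_comm _ v]

theorem IsTree.depth_adj (hT : T.IsTree) (huv : u = v ∨ T.Adj u v) (h : T.Adj x y) :
    T.depth u v y = T.depth u v x + 1 ∨ T.depth u v x = T.depth u v y + 1 ∨
      (T.depth u v x = 0 ∧ T.depth u v y = 0) := by
  have key : ∀ {u v x y : V}, T.Adj u v → T.Adj x y → T.dist v x = T.dist u x + 1 →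
      T.dist u y = T.dist v y + 1 → T.dist u x = T.dist v y → T.dist v y = 0 := by
    intro u v x y huv h h1 h2 h3
    by_contra h0
    obtain ⟨z, hz, hdz⟩ := hT.connected.exists_adj_dist_eq_add_one v (Nat.pos_of_ne_zero h0)
    have h4 : T.dist u z ≤ T.dist u y := by
      have := hT.connected.dist_triangle (u := u) (v := v) (w := z)
      rw [dist_eq_one_iff_adj.2 huv] at this
      omega
    have := hT.eq_of_adj_of_dist_le u hz h.symm h4 (by omega)
    subst this
    omega
  have hu := hT.dist_eq_dist_add_one_of_adj u h
  have hv := hT.dist_eq_dist_add_one_of_adj v h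
  unfold depth
  rcases huv with rfl | huv
  · omega
  · have hx := hT.dist_eq_dist_add_one_of_adj x huv
    have hy := hT.dist_eq_dist_add_one_of_adj y huv
    have k1 := key huv h
    have k2 := key huv.symm h
    simp only [T.dist_comm (u := x), T.dist_comm (u := y)] at hx hy
    omega

theorem IsTree.eq_of_adj_of_depth_le (hT : T.IsTree) (huv : u = v ∨ T.Adj u v)
    (hy : T.Adj x y) (hz : T.Adj x z)
    (hdy : T.depth u v y ≤ T.depth u v x) (hdz : T.depth u v z ≤ T.depth u v x) : y = z := by
  rcases huv with rfl | huv
  · simp only [depth, min_self] at hdy hdz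
    exact hT.eq_of_adj_of_dist_le u hy hz hdy hdz
  · have key : ∀ {u v : V}, T.Adj u v → T.dist v x = T.dist u x + 1 →
        T.depth u v y ≤ T.depth u v x → T.depth u v z ≤ T.depth u v x → y = z := by
      intro u v huv h1 h2 h3
      have hcl : ∀ w, T.Adj x w → T.depth u v w ≤ T.depth u v x → T.dist v w ≤ T.dist v x := by
        intro w hw hdw
        have a1 := hT.dist_eq_dist_add_one_of_adj v hw
        have a2 := hT.dist_eq_dist_add_one_of_adj w huv
        simp only [T.dist_comm (u := w)] at a2
        unfold depth at hdw
        omega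
      exact hT.eq_of_adj_of_dist_le v hy hz (hcl y hy h2) (hcl z hz h3)
    have hx := hT.dist_eq_dist_add_one_of_adj x huv
    simp only [T.dist_comm (u := x)] at hx
    rcases hx with hx | hx
    · refine key huv.symm hx ?_ ?_ <;> simpa only [depth, min_comm]
    · exact key huv hx hdy hdz

theorem IsTree.exists_adj_depth_eq_add_one (hT : T.IsTree) (huv : u = v ∨ T.Adj u v)
    (hx : 0 < T.depth u v x) : ∃ y, T.Adj x y ∧ T.depth u v x = T.depth u v y + 1 := by
  have hx' := hx
  rw [depth, lt_min_iff] at hx'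
  rcases le_total (T.dist u x) (T.dist v x) with h | h
  · obtain ⟨y, hy, hd⟩ := hT.connected.exists_adj_dist_eq_add_one u hx'.1
    refine ⟨y, hy, ?_⟩
    have := hT.depth_adj huv hy
    unfold depth at *
    omega
  · obtain ⟨y, hy, hd⟩ := hT.connected.exists_adj_dist_eq_add_one v hx'.2
    refine ⟨y, hy, ?_⟩
    have := hT.depth_adj huv hy
    unfold depth at *
    omega

theorem Iso.dist_apply (φ : T ≃g T) (hT : T.Connected) (x y : V) :
    T.dist (φ x) (φ y) = T.dist x y := by
  have key : ∀ (ψ : T ≃g T) (x y : V), T.dist (ψ x) (ψ y) ≤ T.dist x y := by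
    intro ψ x y
    obtain ⟨p, hp⟩ := hT.exists_walk_length_eq_dist x y
    rw [← hp, ← Walk.length_map ψ.toHom p]
    exact dist_le _
  refine le_antisymm (key φ x y) ?_
  simpa using key φ.symm (φ x) (φ y)

variable [Fintype V] [DecidableRel T.Adj]

theorem IsTree.exists_adj_depth_eq_succ (hT : T.IsTree) (huv : u = v ∨ T.Adj u v)
    (hx : 2 ≤ T.degree x) : ∃ y, T.Adj x y ∧ T.depth u v y = T.depth u v x + 1 := by
  rw [← card_neighborFinset_eq_degree] at hx
  obtain ⟨y, hy, z, hz, hyz⟩ := Finset.one_lt_card.1 hx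
  rw [mem_neighborFinset] at hy hz
  by_contra! hcon
  refine hyz (hT.eq_of_adj_of_depth_le huv hy hz ?_ ?_)
  · have := hT.depth_adj huv hy
    have := hcon y hy
    omega
  · have := hT.depth_adj huv hz
    have := hcon z hz
    omega

theorem IsTree.two_le_degree [Nontrivial V] (hT : T.IsTree) (hx : T.degree x ≠ 1) :
    2 ≤ T.degree x := by
  have := hT.connected.preconnected.degree_pos_of_nontrivial x
  omega

theorem IsTree.exists_leaf_dist_eq_add [Nontrivial V] (hT : T.IsTree) (w z : V) :
    ∃ x, T.degree x = 1 ∧ T.dist w x = T.dist w z + T.dist z x := by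
  classical
  let s : Finset V := {x | T.dist w x = T.dist w z + T.dist z x}
  obtain ⟨x, hxs, hmax⟩ := s.exists_max_image (fun x => T.dist z x) ⟨z, by simp [s]⟩
  simp only [s, Finset.mem_filter, Finset.mem_univ, true_and] at hxs hmax
  refine ⟨x, ?_, hxs⟩
  by_contra hx
  obtain ⟨y, hy, hd⟩ :=
    hT.exists_adj_depth_eq_succ (u := w) (v := w) (Or.inl rfl) (hT.two_le_degree hx)
  simp only [depth, min_self] at hd
  have h1 := hT.connected.dist_triangle (u := w) (v := z) (w := y)
  have h2 := hy.diff_dist_adj (u := z)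
  have h3 := hmax y (by omega)
  omega

/-- `T` is a tree centred at the vertex or edge `{u, v}`: all leaves are at distance `ℓ` from
`{u, v}` and all other vertices have degree `k`. -/
structure IsCenteredTree (T : SimpleGraph V) [DecidableRel T.Adj] (u v : V) (ℓ k : ℕ) : Prop where
  isTree : T.IsTree
  eq_or_adj : u = v ∨ T.Adj u v
  depth_of_leaf : ∀ x, T.degree x = 1 → T.depth u v x = ℓ
  degree_of_not_leaf : ∀ x, T.degree x ≠ 1 → T.degree x = k

namespace IsCenteredTree

variable {ℓ k : ℕ}

theorem exists_depth_max (hT : T.IsCenteredTree u v ℓ k) (hcard : 3 ≤ Fintype.card V) :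
    0 < ℓ ∧ ∀ x, T.depth u v x ≤ ℓ := by
  classical
  have : Nontrivial V := Fintype.one_lt_card_iff_nontrivial.1 (by omega)
  obtain ⟨x, -, hmax⟩ := Finset.univ.exists_max_image (fun x => T.depth u v x) ⟨u, by simp⟩
  obtain ⟨z, hz⟩ : ∃ z, z ∉ ({u, v} : Finset V) := by
    by_contra! hcon
    have h1 : Finset.univ ⊆ ({u, v} : Finset V) := fun z _ => hcon z
    have h2 := Finset.card_le_card h1
    have h3 : ({u, v} : Finset V).card ≤ 2 := Finset.card_le_two
    rw [Finset.card_univ] at h2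
    omega
  have hz0 : T.depth u v z ≠ 0 := by
    rw [Ne, depth_eq_zero_iff hT.isTree.connected]
    simpa using hz
  have hleaf : T.degree x = 1 := by
    by_contra hx
    obtain ⟨y, hy, hd⟩ :=
      hT.isTree.exists_adj_depth_eq_succ hT.eq_or_adj (hT.isTree.two_le_degree hx)
    have := hmax y (Finset.mem_univ y)
    omega
  have h1 := hmax z (Finset.mem_univ z)
  rw [hT.depth_of_leaf x hleaf] at h1 hmax
  exact ⟨by omega, fun y => hmax y (Finset.mem_univ y)⟩

theorem degree_eq_one_iff (hT : T.IsCenteredTree u v ℓ k) (hcard : 3 ≤ Fintype.card V) (x : V) :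
    T.degree x = 1 ↔ T.depth u v x = ℓ := by
  have : Nontrivial V := Fintype.one_lt_card_iff_nontrivial.1 (by omega)
  refine ⟨hT.depth_of_leaf x, fun h => ?_⟩
  by_contra hx
  obtain ⟨y, hy, hd⟩ :=
    hT.isTree.exists_adj_depth_eq_succ hT.eq_or_adj (hT.isTree.two_le_degree hx)
  have := (hT.exists_depth_max hcard).2 y
  omega

theorem degree_eq (hT : T.IsCenteredTree u v ℓ k) (hcard : 3 ≤ Fintype.card V)
    (hx : T.depth u v x < ℓ) : T.degree x = k :=
  hT.degree_of_not_leaf x (by rw [Ne, hT.degree_eq_one_iff hcard]; omega)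

theorem degree_left (hT : T.IsCenteredTree u v ℓ k) (hcard : 3 ≤ Fintype.card V) :
    T.degree u = k := by
  refine hT.degree_eq hcard ?_
  rw [(depth_eq_zero_iff hT.isTree.connected).2 (Or.inl rfl)]
  exact (hT.exists_depth_max hcard).1

theorem two_le (hT : T.IsCenteredTree u v ℓ k) (hcard : 3 ≤ Fintype.card V) : 2 ≤ k := by
  have : Nontrivial V := Fintype.one_lt_card_iff_nontrivial.1 (by omega)
  rw [← hT.degree_left hcard]
  refine hT.isTree.two_le_degree ?_
  rw [Ne, hT.degree_eq_one_iff hcard, (depth_eq_zero_iff hT.isTree.connected).2 (Or.inl rfl)]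
  exact (hT.exists_depth_max hcard).1.ne

theorem degree_le (hT : T.IsCenteredTree u v ℓ k) (hcard : 3 ≤ Fintype.card V) (x : V) :
    T.degree x ≤ k := by
  have := hT.two_le hcard
  by_cases hx : T.degree x = 1
  · omega
  · exact (hT.degree_of_not_leaf x hx).le

theorem maxDegree_eq (hT : T.IsCenteredTree u v ℓ k) (hcard : 3 ≤ Fintype.card V) :
    T.maxDegree = k :=
  le_antisymm (T.maxDegree_le_of_forall_degree_le k (hT.degree_le hcard))
    (hT.degree_left hcard ▸ T.degree_le_maxDegree u)

theorem le_card_children (hT : T.IsCenteredTree u v ℓ k) (hcard : 3 ≤ Fintype.card V)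
    (hx : T.depth u v x < ℓ) :
    k ≤ (T.neighborFinset x |>.filter (fun y => T.depth u v y = T.depth u v x + 1)).card + 1 := by
  rw [← hT.degree_eq hcard hx, ← card_neighborFinset_eq_degree,
    ← Finset.card_filter_add_card_filter_not (s := T.neighborFinset x)
      (fun y => T.depth u v y = T.depth u v x + 1)]
  refine Nat.add_le_add_left (Finset.card_le_one.2 fun y hy z hz => ?_) _
  simp only [Finset.mem_filter, mem_neighborFinset] at hy hz
  have h1 := hT.isTree.depth_adj hT.eq_or_adj hy.1
  have h2 := hT.isTree.depth_adj hT.eq_or_adj hz.1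
  exact hT.isTree.eq_of_adj_of_depth_le hT.eq_or_adj hy.1 hz.1 (by omega) (by omega)

theorem eq_center_of_dist_le (hT : T.IsCenteredTree u v ℓ k) (hcard : 3 ≤ Fintype.card V) (w : V)
    (hw : ∀ x, T.degree x = 1 → T.dist w x ≤ ℓ + T.dist u v) : w = u ∨ w = v := by
  have : Nontrivial V := Fintype.one_lt_card_iff_nontrivial.1 (by omega)
  have key : ∀ z, z = u ∨ z = v → T.dist w z ≤ T.dist u v := by
    intro z hz
    obtain ⟨x, hx, hd⟩ := hT.isTree.exists_leaf_dist_eq_add w z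
    have h1 := hw x hx
    have h2 := hT.depth_of_leaf x hx
    have h3 : T.depth u v x ≤ T.dist z x := by
      rcases hz with rfl | rfl <;> simp [depth]
    omega
  have hu := key u (Or.inl rfl)
  have hv := key v (Or.inr rfl)
  rw [← hT.isTree.connected.dist_eq_zero_iff, ← hT.isTree.connected.dist_eq_zero_iff]
  rcases hT.eq_or_adj with rfl | huv
  · rw [dist_self] at hu
    omega
  · have := hT.isTree.dist_eq_dist_add_one_of_adj w huv
    rw [dist_eq_one_iff_adj.2 huv] at hu hv
    omega

theorem map_center (hT : T.IsCenteredTree u v ℓ k) (hcard : 3 ≤ Fintype.card V) (φ : T ≃g T) :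
    (φ u = u ∧ φ v = v) ∨ (φ u = v ∧ φ v = u) := by
  have hc := hT.isTree.connected
  have key : ∀ z, z = u ∨ z = v → φ z = u ∨ φ z = v := by
    intro z hz
    refine hT.eq_center_of_dist_le hcard _ fun x hx => ?_
    have hx' : T.degree (φ.symm x) = 1 := by rw [φ.symm.degree_eq, hx]
    have h1 := hT.depth_of_leaf _ hx'
    have h2 := φ.dist_apply hc z (φ.symm x)
    rw [RelIso.apply_symm_apply] at h2
    have h3 := hc.dist_triangle (u := u) (v := v) (w := φ.symm x)
    have h4 := hc.dist_triangle (u := v) (v := u) (w := φ.symm x)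
    have h5 : T.dist v u = T.dist u v := T.dist_comm
    unfold depth at h1
    rcases hz with rfl | rfl <;> omega
  have hu := key u (Or.inl rfl)
  have hv := key v (Or.inr rfl)
  by_cases huv : u = v
  · subst huv
    simp_all
  · have : φ u ≠ φ v := fun h => huv (φ.injective h)
    grind

theorem depth_map (hT : T.IsCenteredTree u v ℓ k) (hcard : 3 ≤ Fintype.card V) (φ : T ≃g T)
    (x : V) : T.depth u v (φ x) = T.depth u v x := by
  have hu := φ.dist_apply hT.isTree.connected u x
  have hv := φ.dist_apply hT.isTree.connected v x
  unfold depth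
  rcases hT.map_center hcard φ with ⟨h1, h2⟩ | ⟨h1, h2⟩ <;> rw [h1] at hu <;> rw [h2] at hv
  · rw [hu, hv]
  · rw [hu, hv, min_comm]

end IsCenteredTree

theorem exists_injOn_neighborSet_apply_eq {k : ℕ} (hx : T.degree x ≤ k) (y : V) (t : Fin k) :
    ∃ g : V → Fin k, Set.InjOn g (T.neighborSet x) ∧ g y = t := by
  classical
  obtain ⟨e⟩ : Nonempty (T.neighborSet x ↪ Fin k) :=
    Function.Embedding.nonempty_of_card_le (by rwa [card_neighborSet_eq_degree, Fintype.card_fin])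
  let g : V → Fin k := fun z => if h : z ∈ T.neighborSet x then e ⟨z, h⟩ else t
  have hg : Set.InjOn g (T.neighborSet x) := by
    intro a ha b hb hab
    simp only [g, dif_pos ha, dif_pos hb] at hab
    exact congrArg Subtype.val (e.injective hab)
  exact ⟨Equiv.swap (g y) t ∘ g, (Equiv.injective _).comp_injOn hg, by simp⟩

theorem exists_edgeLabeling_of_height {V : Type*} (T : SimpleGraph V) (δ : V → ℕ) {k : ℕ}
    (hk : 0 < k) (g : V → V → Fin k) :
    ∃ f : T.edgeSet → Fin k, ∀ (p c : V) (h : T.Adj p c), δ c = δ p + 1 →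
      f ⟨s(p, c), h⟩ = g p c := by
  classical
  let P : T.edgeSet → V × V → Prop := fun e q => e.1 = s(q.1, q.2) ∧ δ q.2 = δ q.1 + 1
  refine ⟨fun e => if h : ∃ q, P e q then g h.choose.1 h.choose.2 else ⟨0, hk⟩,
    fun p c h hd => ?_⟩
  have hex : ∃ q, P ⟨s(p, c), h⟩ q := ⟨(p, c), rfl, hd⟩
  obtain ⟨h1, h2⟩ := hex.choose_spec
  refine (dif_pos hex).trans ?_
  rcases Sym2.eq_iff.1 h1 with ⟨h3, h4⟩ | ⟨h3, h4⟩
  · rw [← h3, ← h4]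
  · rw [← h3, ← h4] at h2
    omega

namespace IsCenteredTree

variable {ℓ k : ℕ}

theorem exists_isDistinguishingEdgeLabeling (hT : T.IsCenteredTree u v ℓ k)
    (hcard : 3 ≤ Fintype.card V) :
    ∃ f : T.edgeSet → Fin k, T.IsDistinguishingEdgeLabeling f := by
  classical
  have hk := hT.two_le hcard
  have hc := hT.isTree.connected
  let first : Fin k := ⟨0, by omega⟩
  let last : Fin k := ⟨k - 1, by omega⟩
  have hne : first ≠ last := by
    simp only [first, last, Ne, Fin.mk.injEq]
    omega
  choose g hginj hgval using fun x => exists_injOn_neighborSet_apply_eq (hT.degree_le hcard x)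
    (if x = u then v else u) (if x = u then last else first)
  obtain ⟨f, hf⟩ := T.exists_edgeLabeling_of_height (T.depth u v) (by omega : 0 < k) g
  refine ⟨f, fun φ hφ => ?_⟩
  have hmap : ∀ p c, T.Adj p c → T.depth u v c = T.depth u v p + 1 →
      g (φ p) (φ c) = g p c := by
    intro p c h hd
    have h' : T.Adj (φ p) (φ c) := φ.map_adj_iff.2 h
    rw [← hf p c h hd, ← hφ ⟨s(p, c), h⟩,
      ← hf _ _ h' (by rw [hT.depth_map hcard, hT.depth_map hcard, hd])]
    rfl
  have hroot : φ u = u ∧ φ v = v := by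
    refine (hT.map_center hcard φ).elim id fun ⟨hu, hv⟩ => ?_
    rcases hT.eq_or_adj with rfl | huv
    · exact ⟨hu, hv⟩
    exfalso
    have hsurj : ∃ c, T.Adj u c ∧ g u c = first := by
      have himg : (T.neighborFinset u).image (g u) = Finset.univ := by
        rw [← Finset.card_eq_iff_eq_univ, Finset.card_image_of_injOn (by simpa using hginj u),
          card_neighborFinset_eq_degree, hT.degree_left hcard, Fintype.card_fin]
      have := Finset.mem_univ first
      rw [← himg, Finset.mem_image] at this
      simpa using this
    obtain ⟨c, hadj, hgc⟩ := hsurj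
    have hlast := hgval u
    have hfirst := hgval v
    rw [if_pos rfl, if_pos rfl] at hlast
    rw [if_neg huv.ne', if_neg huv.ne'] at hfirst
    have hcv : c ≠ v := by
      rintro rfl
      exact hne (hgc.symm.trans hlast)
    have hu0 : T.depth u v u = 0 := (depth_eq_zero_iff hc).2 (Or.inl rfl)
    have hc0 : T.depth u v c ≠ 0 := by
      rw [Ne, depth_eq_zero_iff hc]
      exact fun h => h.elim hadj.ne' hcv
    have hm := hmap u c hadj (by have := hT.isTree.depth_adj hT.eq_or_adj hadj; omega)
    have hadj' : T.Adj v (φ c) := hu ▸ φ.map_adj_iff.2 hadj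
    rw [hu, hgc, ← hfirst] at hm
    have := hginj v hadj' huv.symm hm
    rw [← hv] at this
    exact hcv (φ.injective this)
  have key : ∀ n x, T.depth u v x = n → φ x = x := by
    intro n
    induction n with
    | zero =>
      intro x hx
      rcases (depth_eq_zero_iff hc).1 hx with rfl | rfl
      exacts [hroot.1, hroot.2]
    | succ n ih =>
      intro x hx
      obtain ⟨p, hp, hd⟩ :=
        hT.isTree.exists_adj_depth_eq_add_one hT.eq_or_adj (x := x) (by omega)
      have hφp := ih p (by omega)
      have hm := hmap p x hp.symm hd
      have hadj : T.Adj (φ p) (φ x) := φ.map_adj_iff.2 hp.symm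
      rw [hφp] at hm hadj
      exact hginj p hadj hp.symm hm
  exact fun x => key _ x rfl

end IsCenteredTree

/-- The map exchanging `a` and `b` together with everything below them. Here `par x` is the parent
of `x`, and `child p x` is the child of `p` that corresponds to `x`. -/
def swapSubtrees {W : Type*} [DecidableEq W] (δ : W → ℕ) (par : W → W)
    (hpar : ∀ x, 0 < δ x → δ (par x) < δ x) (child : W → W → W) (a b : W) (x : W) : W :=
  if x = a then b else if x = b then a else if _h : 0 < δ x then
    if swapSubtrees δ par hpar child a b (par x) = par x then x
    else child (swapSubtrees δ par hpar child a b (par x)) x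
  else x
termination_by δ x
decreasing_by all_goals exact hpar x ‹_›

theorem exists_iso_swap {V : Type*} {T : SimpleGraph V} (δ : V → ℕ)
    (hadj : ∀ x y, T.Adj x y → δ y = δ x + 1 ∨ δ x = δ y + 1 ∨ (δ x = 0 ∧ δ y = 0))
    (huniq : ∀ x y z, T.Adj x y → T.Adj x z → δ x = δ y + 1 → δ x = δ z + 1 → y = z)
    (hex : ∀ x, 0 < δ x → ∃ y, T.Adj x y ∧ δ x = δ y + 1)
    {α : Type*} (F : Sym2 V → α) (a b : V) (hab : a ≠ b) (hδ : δ a = δ b)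
    (hsib : (δ a = 0 ∧ ∀ x, δ x = 0 → x = a ∨ x = b) ∨
      ∃ p, T.Adj p a ∧ T.Adj p b ∧ δ a = δ p + 1 ∧ F s(p, a) = F s(p, b))
    (hchild : ∀ x y z, δ a ≤ δ x → T.Adj x y → δ y = δ x + 1 → δ z = δ x →
      ∃! w, T.Adj z w ∧ δ w = δ z + 1 ∧ F s(z, w) = F s(x, y)) :
    ∃ φ : T ≃g T, (∀ x y, T.Adj x y → F s(φ x, φ y) = F s(x, y)) ∧ φ a = b := by
  classical
  have hex' : ∀ x, ∃ y, 0 < δ x → T.Adj x y ∧ δ x = δ y + 1 := fun x => by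
    by_cases hx : 0 < δ x
    · obtain ⟨y, hy⟩ := hex x hx
      exact ⟨y, fun _ => hy⟩
    · exact ⟨x, fun h => absurd h hx⟩
  choose par hpar using hex'
  have hparlt : ∀ x, 0 < δ x → δ (par x) < δ x := fun x hx => by
    have := (hpar x hx).2
    omega
  have hpar_eq : ∀ p x, T.Adj p x → δ x = δ p + 1 → par x = p := fun p x h hd =>
    huniq x _ _ (hpar x (by omega)).1 h.symm (hpar x (by omega)).2 hd
  have hch : ∀ z y, ∃ w, (δ a < δ y ∧ δ y = δ z + 1) →
      (T.Adj z w ∧ δ w = δ z + 1 ∧ F s(z, w) = F s(par y, y)) ∧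
      ∀ w', T.Adj z w' → δ w' = δ z + 1 → F s(z, w') = F s(par y, y) → w' = w := by
    intro z y
    by_cases h : δ a < δ y ∧ δ y = δ z + 1
    · obtain ⟨h1, h2⟩ := hpar y (by omega)
      obtain ⟨w, hw, hw'⟩ := hchild (par y) y z (by omega) h1.symm h2 (by omega)
      exact ⟨w, fun _ => ⟨hw, fun w' a1 a2 a3 => hw' w' ⟨a1, a2, a3⟩⟩⟩
    · exact ⟨z, fun h' => absurd h' h⟩
  choose child hchild' using hch
  let σ : V → V := swapSubtrees δ par hparlt child a b
  have hσa : σ a = b := by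
    simp only [σ]; rw [swapSubtrees, if_pos rfl]
  have hσb : σ b = a := by
    simp only [σ]; rw [swapSubtrees, if_neg hab.symm, if_pos rfl]
  have hσ0 : ∀ x, x ≠ a → x ≠ b → δ x = 0 → σ x = x := fun x h1 h2 h3 => by
    simp only [σ]; rw [swapSubtrees, if_neg h1, if_neg h2, dif_neg (by omega)]
  have hσfix : ∀ x, x ≠ a → x ≠ b → 0 < δ x → σ (par x) = par x → σ x = x :=
    fun x h1 h2 h3 h4 => by
      simp only [σ] at h4 ⊢
      rw [swapSubtrees, if_neg h1, if_neg h2, dif_pos h3, if_pos h4]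
  have hσmove : ∀ x, x ≠ a → x ≠ b → 0 < δ x → σ (par x) ≠ par x →
      σ x = child (σ (par x)) x := fun x h1 h2 h3 h4 => by
    simp only [σ] at h4 ⊢
    rw [swapSubtrees, if_neg h1, if_neg h2, dif_pos h3, if_neg h4]
  have main : ∀ n x, δ x = n → δ (σ x) = δ x ∧ σ (σ x) = x ∧ (σ x ≠ x → δ a ≤ δ x) ∧
      (0 < δ x → par (σ x) = σ (par x) ∧ F s(par (σ x), σ x) = F s(par x, x)) := by
    intro n
    induction n using Nat.strong_induction_on with
    | _ n ih =>
    have hsib' : 0 < δ a → δ a = n → par a = par b ∧ σ (par a) = par a ∧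
        F s(par a, a) = F s(par b, b) := by
      intro h0 hn
      rcases hsib with ⟨h, -⟩ | ⟨p, hpa, hpb, hd, hF⟩
      · omega
      rw [hpar_eq p a hpa hd, hpar_eq p b hpb (by omega)]
      refine ⟨rfl, ?_, hF⟩
      by_contra hcon
      have := (ih (δ p) (by omega) p rfl).2.2.1 hcon
      omega
    intro x hx
    by_cases hxa : x = a
    · subst hxa
      rw [hσa, hσb]
      refine ⟨hδ.symm, rfl, fun _ => le_rfl, fun h0 => ?_⟩
      obtain ⟨h1, h2, h3⟩ := hsib' h0 hx
      exact ⟨by rw [h2, h1], h3.symm⟩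
    by_cases hxb : x = b
    · subst hxb
      rw [hσb, hσa]
      refine ⟨hδ, rfl, fun _ => hδ.le, fun h0 => ?_⟩
      obtain ⟨h1, h2, h3⟩ := hsib' (by omega) (by omega)
      exact ⟨by rw [← h1, h2], h3⟩
    rcases Nat.eq_zero_or_pos (δ x) with h0 | h0
    · have h := hσ0 x hxa hxb h0
      exact ⟨by rw [h], by rw [h, h], fun h' => absurd h h', fun h' => by omega⟩
    obtain ⟨hp1, hp2⟩ := hpar x h0
    obtain ⟨ih1, ih2, ih3, -⟩ := ih (δ (par x)) (by omega) (par x) rfl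
    by_cases hfix : σ (par x) = par x
    · have h := hσfix x hxa hxb h0 hfix
      exact ⟨by rw [h], by rw [h, h], fun h' => absurd h h', fun _ => by rw [h, hfix]; simp⟩
    · have h := hσmove x hxa hxb h0 hfix
      have hle := ih3 hfix
      obtain ⟨⟨hw1, hw2, hw3⟩, -⟩ := hchild' (σ (par x)) x ⟨by omega, by omega⟩
      rw [← h] at hw1 hw2 hw3
      have hparw : par (σ x) = σ (par x) := hpar_eq _ _ hw1 hw2
      have hδx : δ (σ x) = δ x := by omega
      refine ⟨hδx, ?_, fun _ => by omega, fun _ => ⟨hparw, by rw [hparw, hw3]⟩⟩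
      have hne1 : σ x ≠ a := fun h' => by rw [h'] at hδx; omega
      have hne2 : σ x ≠ b := fun h' => by rw [h'] at hδx; omega
      rw [hσmove (σ x) hne1 hne2 (by omega) (by rw [hparw, ih2]; exact Ne.symm hfix), hparw, ih2]
      refine ((hchild' (par x) (σ x) ⟨by omega, by omega⟩).2 x hp1.symm hp2 ?_).symm
      rw [hparw, hw3]
  have hδσ : ∀ x, δ (σ x) = δ x := fun x => (main _ x rfl).1
  have hinv : Function.Involutive σ := fun x => (main _ x rfl).2.1
  have hlow : ∀ x, δ x < δ a → σ x = x := fun x hx => by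
    by_contra h
    have := (main _ x rfl).2.2.1 h
    omega
  have hup : ∀ x y, T.Adj x y → δ y = δ x + 1 →
      T.Adj (σ x) (σ y) ∧ F s(σ x, σ y) = F s(x, y) := by
    intro x y h hd
    obtain ⟨h1, h2⟩ := (main _ y rfl).2.2.2 (by omega)
    have hpy := hpar_eq x y h hd
    rw [h1, hpy] at h2
    refine ⟨?_, h2⟩
    have h3 := (hpar (σ y) (by rw [hδσ]; omega)).1
    rw [h1, hpy] at h3
    exact h3.symm
  have hall : ∀ x y, T.Adj x y → T.Adj (σ x) (σ y) ∧ F s(σ x, σ y) = F s(x, y) := by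
    intro x y h
    rcases hadj x y h with hd | hd | ⟨hx, hy⟩
    · exact hup x y h hd
    · rw [Sym2.eq_swap, Sym2.eq_swap (a := x), adj_comm]
      exact hup y x h.symm hd
    · rcases hsib with ⟨-, h0⟩ | ⟨p, -, -, hd, -⟩
      · rcases h0 x hx with rfl | rfl <;> rcases h0 y hy with rfl | rfl
        · exact absurd rfl h.ne
        · rw [hσa, hσb]
          exact ⟨h.symm, by rw [Sym2.eq_swap]⟩
        · rw [hσa, hσb]
          exact ⟨h.symm, by rw [Sym2.eq_swap]⟩
        · exact absurd rfl h.ne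
      · rw [hlow x (by omega), hlow y (by omega)]
        exact ⟨h, rfl⟩
  refine ⟨⟨hinv.toPerm, fun {x y} => ⟨fun h => ?_, fun h => (hall x y h).1⟩⟩,
    fun x y h => (hall x y h).2, hσa⟩
  have := (hall _ _ h).1
  simpa [hinv x, hinv y] using this

namespace IsCenteredTree

variable {ℓ k : ℕ}

theorem le_of_isDistinguishingEdgeLabeling (hT : T.IsCenteredTree u v ℓ k)
    (hcard : 3 ≤ Fintype.card V) {d : ℕ} (f : T.edgeSet → Fin d)
    (hf : T.IsDistinguishingEdgeLabeling f) : k ≤ d := by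
  classical
  by_contra! hdk
  let F : Sym2 V → ℕ := fun e => if h : e ∈ T.edgeSet then (f ⟨e, h⟩ : ℕ) else 0
  have hF : ∀ e : T.edgeSet, F e = f e := fun e => dif_pos e.2
  have hFlt : ∀ x y, T.Adj x y → F s(x, y) < d := fun x y h => by
    rw [hF ⟨s(x, y), h⟩]
    exact (f _).2
  let δ := T.depth u v
  -- pairs that can be exchanged once everything below them is rigid
  let P : V × V → Prop := fun q => q.1 ≠ q.2 ∧ δ q.1 = δ q.2 ∧ (δ q.1 = 0 ∨
    ∃ p, T.Adj p q.1 ∧ T.Adj p q.2 ∧ δ q.1 = δ p + 1 ∧ F s(p, q.1) = F s(p, q.2))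
  have hδ0 : ∀ x, δ x = 0 ↔ x = u ∨ x = v := fun x => depth_eq_zero_iff hT.isTree.connected
  have hu0 : δ u = 0 := (hδ0 u).2 (Or.inl rfl)
  have hv0 : δ v = 0 := (hδ0 v).2 (Or.inr rfl)
  have hP : ∃ q, P q := by
    by_cases huv : u = v
    · subst huv
      have hmaps : ∀ y ∈ T.neighborFinset u, F s(u, y) ∈ Finset.range d := fun y hy => by
        rw [mem_neighborFinset] at hy
        exact Finset.mem_range.2 (hFlt u y hy)
      obtain ⟨a, ha, b, hb, hab, hFab⟩ := Finset.exists_ne_map_eq_of_card_lt_of_maps_to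
        (by rw [Finset.card_range, card_neighborFinset_eq_degree, hT.degree_left hcard]; exact hdk)
        hmaps
      rw [mem_neighborFinset] at ha hb
      have hone : ∀ y, T.Adj u y → δ y = δ u + 1 := fun y hy => by
        have h1 : δ y = δ u + 1 ∨ δ u = δ y + 1 ∨ (δ u = 0 ∧ δ y = 0) :=
          hT.isTree.depth_adj hT.eq_or_adj hy
        have h2 : δ y ≠ 0 := by
          rw [Ne, hδ0, or_self]
          exact hy.ne'
        omega
      exact ⟨(a, b), hab, by rw [hone a ha, hone b hb], Or.inr ⟨u, ha, hb, hone a ha, hFab⟩⟩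
    · exact ⟨(u, v), huv, by rw [hu0, hv0], Or.inl hu0⟩
  obtain ⟨q₀, hq₀⟩ := hP
  obtain ⟨⟨a, b⟩, hq, hmax⟩ := (Finset.univ.filter P).exists_max_image (fun q => δ q.1)
    ⟨q₀, by simpa using hq₀⟩
  simp only [Finset.mem_filter, Finset.mem_univ, true_and] at hq hmax
  obtain ⟨hab, hδab, hsib⟩ := hq
  dsimp only at hab hδab hsib hmax
  have hinj : ∀ x y z, δ a ≤ δ x → T.Adj x y → T.Adj x z → δ y = δ x + 1 → δ z = δ x + 1 →
      F s(x, y) = F s(x, z) → y = z := by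
    intro x y z hx hy hz hdy hdz hFyz
    by_contra hyz
    have := hmax (y, z) ⟨hyz, hdy.trans hdz.symm, Or.inr ⟨x, hy, hz, hdy, hFyz⟩⟩
    dsimp only at this
    omega
  obtain ⟨φ, hφ, hφa⟩ := exists_iso_swap (T := T) δ
    (fun x y h => hT.isTree.depth_adj hT.eq_or_adj h)
    (fun x y z hy hz h1 h2 => hT.isTree.eq_of_adj_of_depth_le hT.eq_or_adj hy hz
      (Nat.le_of_succ_le h1.ge) (Nat.le_of_succ_le h2.ge))
    (fun x hx => hT.isTree.exists_adj_depth_eq_add_one hT.eq_or_adj hx) F a b hab hδab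
    (by
      refine hsib.imp_left fun h0 => ⟨h0, fun x hx => ?_⟩
      have ha := (hδ0 a).1 h0
      have hb := (hδ0 b).1 (hδab ▸ h0)
      have hx := (hδ0 x).1 hx
      grind)
    (by
      intro x y z hx hy hdy hzx
      have hzℓ : δ z < ℓ := by
        have : δ y ≤ ℓ := (hT.exists_depth_max hcard).2 y
        omega
      have hcount := hT.le_card_children hcard hzℓ
      set C := T.neighborFinset z |>.filter (fun y => T.depth u v y = T.depth u v z + 1) with hC
      have hmem : ∀ w, w ∈ C ↔ T.Adj z w ∧ δ w = δ z + 1 := fun w => by simp [hC, δ]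
      have hCinj : Set.InjOn (fun w => F s(z, w)) C := fun w hw w' hw' h => by
        rw [Finset.mem_coe, hmem] at hw hw'
        exact hinj z w w' (by omega) hw.1 hw'.1 hw.2 hw'.2 h
      have himg : C.image (fun w => F s(z, w)) = Finset.range d := by
        refine Finset.eq_of_subset_of_card_le (fun i hi => ?_) ?_
        · obtain ⟨w, hw, rfl⟩ := Finset.mem_image.1 hi
          exact Finset.mem_range.2 (hFlt z w ((hmem w).1 hw).1)
        · rw [Finset.card_image_of_injOn hCinj, Finset.card_range]
          omega
      have hmemF := Finset.mem_range.2 (hFlt x y hy)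
      rw [← himg, Finset.mem_image] at hmemF
      obtain ⟨w, hw, hFw⟩ := hmemF
      refine ⟨w, ⟨((hmem w).1 hw).1, ((hmem w).1 hw).2, hFw⟩, fun w' hw' => ?_⟩
      exact hCinj ((hmem w').2 ⟨hw'.1, hw'.2.1⟩) hw (hw'.2.2.trans hFw.symm))
  refine hab ((hf φ (fun e => ?_) a).symm.trans hφa)
  obtain ⟨e, he⟩ := e
  induction e using Sym2.ind with
  | _ x y =>
    apply Fin.ext
    rw [← hF, ← hF]
    exact hφ x y he

theorem distinguishingIndex_eq (hT : T.IsCenteredTree u v ℓ k) (hcard : 3 ≤ Fintype.card V) :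
    T.distinguishingIndex = k := by
  have hmem := hT.exists_isDistinguishingEdgeLabeling hcard
  exact le_antisymm (Nat.sInf_le hmem)
    (le_csInf ⟨k, hmem⟩ fun d ⟨f, hf⟩ => hT.le_of_isDistinguishingEdgeLabeling hcard f hf)

end IsCenteredTree

end SimpleGraph

theorem distinguishingIndex_eq_maxDegree_of_symmetric_or_bisymmetric_tree
    {V : Type*} [Fintype V] (T : SimpleGraph V) [DecidableRel T.Adj]
    (hcard : 3 ≤ Fintype.card V)
    (h : T.IsSymmetricTree ∨ T.IsBisymmetricTree) :
    T.distinguishingIndex = T.maxDegree := by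
  obtain ⟨u, v, ℓ, k, hT⟩ : ∃ u v ℓ k, T.IsCenteredTree u v ℓ k := by
    rcases h with ⟨hT, v₀, ⟨ℓ, hℓ⟩, k, hk⟩ | ⟨hT, u₀, v₀, hadj, ⟨ℓ, hℓ⟩, k, hk⟩
    · exact ⟨v₀, v₀, ℓ, k, hT, Or.inl rfl, fun x hx => by simp [SimpleGraph.depth, hℓ x hx], hk⟩
    · exact ⟨u₀, v₀, ℓ, k, hT, Or.inr hadj, hℓ, hk⟩
  rw [hT.distinguishingIndex_eq hcard, hT.maxDegree_eq hcard]
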